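/- Let n ≥ 1 and let S ⊆ ℝ^n be a Borel set with S ∩ (−S) = ∅ and λ = Vol_n(S) ∈ (0, ∞). Let μ be any SL_n(ℝ)-invariant Borel probability measure on the space 𝒳_n of covolume-one lattices in ℝ^n. Then for every integer ℓ with 0 ≤ ℓ ≤ n − 1, μ({L ∈ 𝒳_n : L ∩ S contains ℓ linearly independent vectors}) ≤ λ^ℓ / ℓ!. -/

import Mathlib

open MeasureTheory Pointwise
open scoped ENNReal

noncomputable section

/-- `SL(n, ℝ)`, the special linear group of `n × n` real matrices of determinant one. -/
abbrev SLR (n : ℕ) := Matrix.SpecialLinearGroup (Fin n) ℝ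

/-- The topology on `SL(n, ℝ)` induced from the space of matrices. -/
instance (n : ℕ) : TopologicalSpace (SLR n) :=
  TopologicalSpace.induced (fun g => (g : Matrix (Fin n) (Fin n) ℝ)) inferInstance

/-- The subgroup `SL(n, ℤ)` of `SL(n, ℝ)` (the range of the coefficient-wise
integer-to-real map on special linear groups). -/
def SLZ (n : ℕ) : Subgroup (SLR n) :=
  MonoidHom.range (Matrix.SpecialLinearGroup.map (n := Fin n) (Int.castRingHom ℝ))

/-- The space `𝒳ₙ = SL(n, ℝ) / SL(n, ℤ)` of lattices of covolume one in `ℝⁿ`. -/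
def LatticeSpace (n : ℕ) := SLR n ⧸ SLZ n

instance (n : ℕ) : TopologicalSpace (LatticeSpace n) :=
  inferInstanceAs (TopologicalSpace (SLR n ⧸ SLZ n))

/-- The Borel σ-algebra on the space of lattices. -/
instance (n : ℕ) : MeasurableSpace (LatticeSpace n) := borel _

/-- The action of `SL(n, ℝ)` on the space of lattices, `g.L = {g x : x ∈ L}`. -/
instance (n : ℕ) : MulAction (SLR n) (LatticeSpace n) :=
  inferInstanceAs (MulAction (SLR n) (SLR n ⧸ SLZ n))

/-- The lattice `{g v : v ∈ ℤⁿ} ⊆ ℝⁿ` associated to a point of `LatticeSpace n`,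
computed via a representative `g` of the coset (the resulting set of vectors does not
depend on the choice of representative, since `SL(n, ℤ)` preserves `ℤⁿ`). -/
def latticeOf {n : ℕ} (L : LatticeSpace n) : Set (Fin n → ℝ) :=
  {y | ∃ v : Fin n → ℤ,
    y = (Quotient.out (α := SLR n) L).1.mulVec (fun i => (v i : ℝ))}

/-- A set `X ⊆ ℝⁿ` consists of linearly independent vectors. -/
def indepSet {n : ℕ} (X : Set (Fin n → ℝ)) : Prop :=
  LinearIndependent ℝ (fun x : X => (x : Fin n → ℝ))

open Filter Topology

section Euclidean

variable {n ℓ : ℕ}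

instance : (volume : Measure (Fin n → Fin ℓ → ℝ)).IsAddHaarMeasure :=
  Measure.instIsAddHaarMeasureForallVolumeOfMeasurableAddOfSigmaFinite

instance : (volume : Measure ((Fin n → Fin ℓ → ℝ) × (Fin ℓ → ℝ))).IsAddHaarMeasure :=
  Measure.prod.instIsAddHaarMeasure (G := Fin n → Fin ℓ → ℝ) _ _

lemma measurePreserving_transpose (n ℓ : ℕ) :
    MeasurePreserving (fun (X : Fin n → Fin ℓ → ℝ) (j : Fin ℓ) (i : Fin n) => X i j) := by
  let e : (Fin n → Fin ℓ → ℝ) ≃ₗ[ℝ] (Fin ℓ → Fin n → ℝ) :=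
    { toFun := fun X j i => X i j
      invFun := fun X i j => X j i
      map_add' := fun _ _ => rfl
      map_smul' := fun _ _ => rfl
      left_inv := fun _ => rfl
      right_inv := fun _ => rfl }
  have hc : Continuous e := e.toLinearMap.continuous_of_finiteDimensional
  refine ⟨hc.measurable, ?_⟩
  change Measure.map e volume = volume
  have h := Measure.isAddLeftInvariant_eq_smul
    (Measure.map e (volume : Measure (Fin n → Fin ℓ → ℝ)))
    (volume : Measure (Fin ℓ → Fin n → ℝ))
  have hcube (a b : ℕ) : volume
      (Set.univ.pi fun _ => Set.univ.pi fun _ => Set.Icc 0 1 : Set (Fin a → Fin b → ℝ)) = 1 := by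
    simp only [volume_pi_pi, Real.volume_Icc, sub_zero, ENNReal.ofReal_one, Finset.prod_const_one]
  have h1 : Measure.map e volume (Set.univ.pi fun _ => Set.univ.pi fun _ => Set.Icc 0 1) = 1 := by
    rw [Measure.map_apply hc.measurable (MeasurableSet.univ_pi fun _ =>
      MeasurableSet.univ_pi fun _ => measurableSet_Icc), ← hcube n ℓ]
    congr 1
    ext X
    simp only [Set.mem_preimage, Set.mem_univ_pi]
    exact forall_comm
  rw [h, Measure.smul_apply, hcube] at h1
  generalize (Measure.map e volume).addHaarScalarFactor volume = c at h h1
  have : c = 1 := by simpa [ENNReal.smul_def] using h1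
  rw [h, this, one_smul]

/-- The action of `n × n` matrices on `n × ℓ` matrices, the latter regarded as families of rows. -/
def rowAct (g : Matrix (Fin n) (Fin n) ℝ) (X : Fin n → Fin ℓ → ℝ) : Fin n → Fin ℓ → ℝ :=
  fun i => ∑ k, g i k • X k

lemma rowAct_apply (g : Matrix (Fin n) (Fin n) ℝ) (X : Fin n → Fin ℓ → ℝ) (i : Fin n)
    (j : Fin ℓ) : rowAct g X i j = ∑ k, g i k * X k j := by
  simp [rowAct]

lemma rowAct_one (X : Fin n → Fin ℓ → ℝ) : rowAct 1 X = X := by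
  ext i j
  simp [rowAct_apply, Matrix.one_apply]

lemma rowAct_mul (g h : Matrix (Fin n) (Fin n) ℝ) (X : Fin n → Fin ℓ → ℝ) :
    rowAct (g * h) X = rowAct g (rowAct h X) := by
  ext i j
  simp only [rowAct_apply, Matrix.mul_apply, Finset.sum_mul, Finset.mul_sum]
  rw [Finset.sum_comm]
  simp only [mul_assoc]

lemma rowAct_smul (g : Matrix (Fin n) (Fin n) ℝ) (c : ℝ) (X : Fin n → Fin ℓ → ℝ) :
    rowAct g (c • X) = c • rowAct g X := by
  ext i j
  simp only [rowAct_apply, Pi.smul_apply, smul_eq_mul, Finset.mul_sum]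
  exact Finset.sum_congr rfl fun k _ => by ring

lemma continuous_rowAct :
    Continuous fun p : Matrix (Fin n) (Fin n) ℝ × (Fin n → Fin ℓ → ℝ) => rowAct p.1 p.2 := by
  unfold rowAct
  fun_prop

lemma measurePreserving_mulVec {g : Matrix (Fin n) (Fin n) ℝ} (hg : g.det = 1) :
    MeasurePreserving (fun v : Fin n → ℝ => g.mulVec v) := by
  refine ⟨by fun_prop, ?_⟩
  have h := Real.map_matrix_volume_pi_eq_smul_volume_pi (M := g) (by simp [hg])
  rw [hg, inv_one, abs_one, ENNReal.ofReal_one, one_smul] at h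
  exact h

lemma measurePreserving_rowAct {g : Matrix (Fin n) (Fin n) ℝ} (hg : g.det = 1) :
    MeasurePreserving (rowAct g : (Fin n → Fin ℓ → ℝ) → _) := by
  have h := (measurePreserving_transpose ℓ n).comp
    ((volume_preserving_pi fun _ : Fin ℓ => measurePreserving_mulVec hg).comp
      (measurePreserving_transpose n ℓ))
  convert h using 1
  ext X i j
  simp [rowAct_apply, Matrix.mulVec, dotProduct]

lemma measurePreserving_update_swap (i : Fin n) :
    MeasurePreserving (fun p : (Fin n → Fin ℓ → ℝ) × (Fin ℓ → ℝ) =>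
      (Function.update p.1 i p.2, p.1 i)) := by
  let T : ((Fin n → Fin ℓ → ℝ) × (Fin ℓ → ℝ)) →ₗ[ℝ] ((Fin n → Fin ℓ → ℝ) × (Fin ℓ → ℝ)) :=
    { toFun := fun p => (Function.update p.1 i p.2, p.1 i)
      map_add' := fun p q => by simp [Function.update_add]
      map_smul' := fun c p => by simp [Function.update_smul] }
  have hTT : T * T = 1 := by
    refine LinearMap.ext fun p => ?_
    simp [T]
  have hdet : LinearMap.det T * LinearMap.det T = 1 := by rw [← map_mul, hTT, map_one]
  have hne : LinearMap.det T ≠ 0 := fun h => by simp [h] at hdet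
  have habs : |(LinearMap.det T)⁻¹| = 1 := by
    rw [abs_inv, inv_eq_one]
    exact (mul_self_eq_one_iff.1 hdet).elim (fun h => by simp [h]) (fun h => by simp [h])
  refine ⟨T.continuous_of_finiteDimensional.measurable, ?_⟩
  have h := Measure.map_linearMap_addHaar_eq_smul_addHaar volume hne
  rw [habs, ENNReal.ofReal_one, one_smul] at h
  exact h

/-- Change of variables `v ↦ A v - c` in a Lebesgue integral. -/
lemma lintegral_mulVec_sub {A : Matrix (Fin ℓ) (Fin ℓ) ℝ} (hA : A.det ≠ 0) (c : Fin ℓ → ℝ)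
    {ψ : (Fin ℓ → ℝ) → ℝ≥0∞} (hψ : Measurable ψ) :
    ∫⁻ v, ψ (A.mulVec v - c) = ENNReal.ofReal |A.det⁻¹| * ∫⁻ s, ψ s := by
  have h := Real.map_matrix_volume_pi_eq_smul_volume_pi hA
  have hm : Measurable fun s => ψ (s - c) := by fun_prop
  calc ∫⁻ v, ψ (A.mulVec v - c)
      = ∫⁻ s, ψ (s - c) ∂(Measure.map (Matrix.toLin' A) volume) := by
        rw [lintegral_map hm (LinearMap.continuous_of_finiteDimensional _).measurable]
        simp
    _ = _ := by
        rw [h, lintegral_smul_measure, lintegral_sub_right_eq_self ψ c, smul_eq_mul]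

/-- The matrix of coordinatewise floors. -/
def floorMat (y : Fin n → Fin ℓ → ℝ) : Fin n → Fin ℓ → ℤ := fun i j => ⌊y i j⌋

/-- The coercion of integer matrices to real ones. -/
def castMat (M : Fin n → Fin ℓ → ℤ) : Fin n → Fin ℓ → ℝ := fun i j => M i j

lemma measurable_floorMat : Measurable (floorMat : (Fin n → Fin ℓ → ℝ) → _) := by
  unfold floorMat
  exact measurable_pi_lambda _ fun i => measurable_pi_lambda _ fun j =>
    Int.measurable_floor.comp (by fun_prop)

lemma lintegral_floorMat (a : (Fin n → Fin ℓ → ℤ) → ℝ≥0∞) :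
    ∫⁻ y, a (floorMat y) = ∑' M, a M := by
  have ha : Measurable a := measurable_of_countable a
  rw [← lintegral_map ha measurable_floorMat, lintegral_countable']
  refine tsum_congr fun M => ?_
  have : Measure.map floorMat volume {M} = 1 := by
    rw [Measure.map_apply measurable_floorMat (measurableSet_singleton M)]
    have : floorMat ⁻¹' {M} =
        Set.univ.pi fun i => Set.univ.pi fun j => Set.Ico (M i j : ℝ) (M i j + 1) := by
      ext y
      simp [floorMat, funext_iff, Int.floor_eq_iff]
    rw [this]
    simp [volume_pi_pi]
  rw [this, mul_one]

/-- A lattice sum as an integral over the mesh of size `ε`. -/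
lemma lintegral_floorMat_inv_smul {ε : ℝ} (hε : 0 < ε) (a : (Fin n → Fin ℓ → ℤ) → ℝ≥0∞) :
    ∫⁻ y : Fin n → Fin ℓ → ℝ, a (floorMat (ε⁻¹ • y)) =
      ENNReal.ofReal (ε ^ (n * ℓ)) * ∑' M, a M := by
  have ha : Measurable fun y : Fin n → Fin ℓ → ℝ => a (floorMat y) :=
    (measurable_of_countable a).comp measurable_floorMat
  rw [← lintegral_map ha (measurable_const_smul ε⁻¹),
    Measure.map_addHaar_smul volume (inv_ne_zero hε.ne'), lintegral_smul_measure,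
    lintegral_floorMat, smul_eq_mul]
  congr 2
  simp [abs_of_pos hε, Module.finrank_pi_fintype]

lemma norm_smul_floorMat_sub_le {ε : ℝ} (hε : 0 < ε) (y : Fin n → Fin ℓ → ℝ) :
    ‖ε • castMat (floorMat (ε⁻¹ • y)) - y‖ ≤ ε := by
  refine (pi_norm_le_iff_of_nonneg hε.le).2 fun i => (pi_norm_le_iff_of_nonneg hε.le).2 fun j => ?_
  have h : (ε • castMat (floorMat (ε⁻¹ • y)) - y) i j = -(ε * Int.fract (ε⁻¹ * y i j)) := by
    simp only [castMat, floorMat, Pi.sub_apply, Pi.smul_apply, smul_eq_mul, Int.fract]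
    field_simp
    ring
  rw [h, norm_neg, Real.norm_of_nonneg (mul_nonneg hε.le (Int.fract_nonneg _))]
  exact mul_le_of_le_one_right hε.le (Int.fract_lt_one _).le

end Euclidean

section Kernel

variable {n ℓ : ℕ}

/-- The `ℓ × ℓ` matrix whose columns are the rows of `Y` selected by `e`. -/
def rowMinor (e : Fin ℓ → Fin n) (Y : Fin n → Fin ℓ → ℝ) : Matrix (Fin ℓ) (Fin ℓ) ℝ :=
  fun j k => Y (e k) j

lemma continuous_rowMinor (e : Fin ℓ → Fin n) : Continuous (rowMinor e) := by
  unfold rowMinor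
  exact continuous_matrix fun i j => by fun_prop

lemma rowMinor_update {e : Fin ℓ → Fin n} {i₀ : Fin n} (hi₀ : ∀ j, e j ≠ i₀)
    (Y : Fin n → Fin ℓ → ℝ) (v : Fin ℓ → ℝ) :
    rowMinor e (Function.update Y i₀ v) = rowMinor e Y := by
  ext j k
  simp [rowMinor, hi₀ k]

lemma rowMinor_mulVec (e : Fin ℓ → Fin n) (Y : Fin n → Fin ℓ → ℝ) (s : Fin ℓ → ℝ) :
    (rowMinor e Y).mulVec s = ∑ k, s k • Y (e k) := by
  ext j
  simp [rowMinor, Matrix.mulVec, dotProduct, mul_comm]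

/-- The density obtained by averaging `f` over shears, with weight `w`, of the row `i₀` by the
rows selected by `e`. -/
def shearKernel (e : Fin ℓ → Fin n) (i₀ : Fin n) (w : (Fin ℓ → ℝ) → ℝ)
    (f : (Fin n → Fin ℓ → ℝ) → ℝ) (Y : Fin n → Fin ℓ → ℝ) (h : ℝ) (v : Fin ℓ → ℝ) : ℝ :=
  w ((rowMinor e Y)⁻¹.mulVec (h • v - Y i₀)) * f (Function.update Y i₀ v) *
    |(rowMinor e Y).det|⁻¹

variable {e : Fin ℓ → Fin n} {i₀ : Fin n} {w : (Fin ℓ → ℝ) → ℝ} {f : (Fin n → Fin ℓ → ℝ) → ℝ}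

lemma continuous_shearKernel (hi₀ : ∀ j, e j ≠ i₀) (hw : Continuous w) (hf : Continuous f)
    (hfe : tsupport f ⊆ {Y | (rowMinor e Y).det ≠ 0}) :
    Continuous fun p : (Fin n → Fin ℓ → ℝ) × ℝ × (Fin ℓ → ℝ) =>
      shearKernel e i₀ w f p.1 p.2.1 p.2.2 := by
  have hupd : Continuous fun p : (Fin n → Fin ℓ → ℝ) × ℝ × (Fin ℓ → ℝ) =>
      Function.update p.1 i₀ p.2.2 := continuous_fst.update i₀ (by fun_prop)
  have hmin : Continuous fun p : (Fin n → Fin ℓ → ℝ) × ℝ × (Fin ℓ → ℝ) => rowMinor e p.1 :=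
    (continuous_rowMinor e).comp continuous_fst
  refine continuous_iff_continuousAt.2 fun p => ?_
  by_cases hp : (rowMinor e p.1).det = 0
  · have hnot : Function.update p.1 i₀ p.2.2 ∉ tsupport f := fun hmem =>
      hfe hmem (by rw [rowMinor_update hi₀, hp])
    have hev : ∀ᶠ q : (Fin n → Fin ℓ → ℝ) × ℝ × (Fin ℓ → ℝ) in 𝓝 p,
        Function.update q.1 i₀ q.2.2 ∉ tsupport f :=
      hupd.continuousAt.eventually ((isClosed_tsupport f).isOpen_compl.mem_nhds hnot)
    refine (continuousAt_const (y := (0 : ℝ))).congr (hev.mono fun q hq => ?_)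
    simp [shearKernel, image_eq_zero_of_notMem_tsupport hq]
  · have hdet : ContinuousAt (fun q : (Fin n → Fin ℓ → ℝ) × ℝ × (Fin ℓ → ℝ) =>
        (rowMinor e q.1).det⁻¹) p := hmin.matrix_det.continuousAt.inv₀ hp
    have hinv : ContinuousAt (fun q : (Fin n → Fin ℓ → ℝ) × ℝ × (Fin ℓ → ℝ) =>
        (rowMinor e q.1)⁻¹) p := by
      simp only [Matrix.inv_def, Ring.inverse_eq_inv']
      exact hdet.smul hmin.matrix_adjugate.continuousAt
    have hvec : ContinuousAt (fun q : (Fin n → Fin ℓ → ℝ) × ℝ × (Fin ℓ → ℝ) =>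
        (rowMinor e q.1)⁻¹.mulVec (q.2.1 • q.2.2 - q.1 i₀)) p := by
      have hc : Continuous fun r : Matrix (Fin ℓ) (Fin ℓ) ℝ × (Fin ℓ → ℝ) => r.1.mulVec r.2 :=
        continuous_fst.matrix_mulVec continuous_snd
      have hd : ContinuousAt (fun q : (Fin n → Fin ℓ → ℝ) × ℝ × (Fin ℓ → ℝ) =>
        q.2.1 • q.2.2 - q.1 i₀) p := by fun_prop
      exact hc.continuousAt.comp (f := fun q : (Fin n → Fin ℓ → ℝ) × ℝ × (Fin ℓ → ℝ) =>
        ((rowMinor e q.1)⁻¹, q.2.1 • q.2.2 - q.1 i₀)) (hinv.prodMk hd)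
    have habs : ContinuousAt (fun q : (Fin n → Fin ℓ → ℝ) × ℝ × (Fin ℓ → ℝ) =>
        |(rowMinor e q.1).det|⁻¹) p := by
      simp only [← abs_inv]
      exact hdet.abs
    exact ((hw.continuousAt.comp hvec).mul (hf.comp hupd).continuousAt).mul habs

lemma exists_bound_of_shearKernel_ne_zero (hi₀ : ∀ j, e j ≠ i₀) (hwc : HasCompactSupport w)
    (hfc : HasCompactSupport f) :
    ∃ R : ℝ, ∀ Y h v, h ∈ Set.Icc (0 : ℝ) 1 → shearKernel e i₀ w f Y h v ≠ 0 →
      ‖Y‖ ≤ R ∧ ‖v‖ ≤ R := by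
  obtain ⟨a, ha⟩ := hfc.isBounded.exists_norm_le
  obtain ⟨b, hb⟩ := hwc.isBounded.exists_norm_le
  refine ⟨max a (a + ℓ * (b * a)), fun Y h v hh hne => ?_⟩
  simp only [shearKernel, ne_eq, mul_eq_zero, not_or, inv_eq_zero, abs_eq_zero] at hne
  obtain ⟨⟨hw', hf'⟩, hdet⟩ := hne
  have hu := ha _ (subset_tsupport f hf')
  have hs := hb _ (subset_tsupport w hw')
  set s := (rowMinor e Y)⁻¹.mulVec (h • v - Y i₀) with hs_def
  have ha0 : 0 ≤ a := (norm_nonneg _).trans hu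
  have hb0 : 0 ≤ b := (norm_nonneg _).trans hs
  have hv : ‖v‖ ≤ a := by simpa using (norm_le_pi_norm (Function.update Y i₀ v) i₀).trans hu
  have hY (i : Fin n) (hi : i ≠ i₀) : ‖Y i‖ ≤ a := by
    simpa [hi] using (norm_le_pi_norm (Function.update Y i₀ v) i).trans hu
  have hBs : (rowMinor e Y).mulVec s = h • v - Y i₀ := by
    rw [hs_def, Matrix.mulVec_mulVec, Matrix.mul_nonsing_inv _ (isUnit_iff_ne_zero.2 hdet),
      Matrix.one_mulVec]
  have hYi : ‖Y i₀‖ ≤ a + ℓ * (b * a) := by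
    have : Y i₀ = h • v - ∑ k, s k • Y (e k) := by
      rw [← rowMinor_mulVec, hBs]
      abel
    rw [this]
    refine (norm_sub_le _ _).trans (add_le_add ?_ ?_)
    · rw [norm_smul, Real.norm_of_nonneg hh.1]
      exact (mul_le_of_le_one_left (norm_nonneg _) hh.2).trans hv
    · refine (norm_sum_le _ _).trans ?_
      calc ∑ k, ‖s k • Y (e k)‖ ≤ ∑ _k : Fin ℓ, b * a := by
            refine Finset.sum_le_sum fun k _ => ?_
            rw [norm_smul]
            exact mul_le_mul ((norm_le_pi_norm s k).trans hs) (hY _ (hi₀ k)) (norm_nonneg _) hb0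
        _ = ℓ * (b * a) := by simp
  refine ⟨(pi_norm_le_iff_of_nonneg (le_max_of_le_left ha0)).2 fun i => ?_, le_max_of_le_left hv⟩
  by_cases hi : i = i₀
  · exact hi ▸ le_max_of_le_right hYi
  · exact le_max_of_le_left (hY i hi)

attribute [local irreducible] shearKernel rowAct

lemma lintegral_shear (hi₀ : ∀ j, e j ≠ i₀) (hw : Continuous w) (hf : Continuous f)
    (hw0 : ∀ s, 0 ≤ w s)
    (hfe : tsupport f ⊆ {Y | (rowMinor e Y).det ≠ 0}) (Y : Fin n → Fin ℓ → ℝ) {h : ℝ}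
    (hh : 0 < h) :
    ∫⁻ s, ENNReal.ofReal (w s) *
        ENNReal.ofReal (f (Function.update Y i₀ (h⁻¹ • (Y i₀ + (rowMinor e Y).mulVec s)))) =
      ENNReal.ofReal (h ^ ℓ) * ∫⁻ v, ENNReal.ofReal (shearKernel e i₀ w f Y h v) := by
  by_cases hdet : (rowMinor e Y).det = 0
  · have h0 (v : Fin ℓ → ℝ) : f (Function.update Y i₀ v) = 0 :=
      image_eq_zero_of_notMem_tsupport fun hmem => hfe hmem (by rw [rowMinor_update hi₀, hdet])
    simp [shearKernel, h0]
  set B := rowMinor e Y with hB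
  have hBu : IsUnit B.det := isUnit_iff_ne_zero.2 hdet
  let ψ : (Fin ℓ → ℝ) → ℝ≥0∞ := fun s => ENNReal.ofReal (w s) *
    ENNReal.ofReal (f (Function.update Y i₀ (h⁻¹ • (Y i₀ + B.mulVec s))))
  have hψ : Measurable ψ := by
    have : Continuous fun s => Function.update Y i₀ (h⁻¹ • (Y i₀ + B.mulVec s)) :=
      continuous_const.update i₀ (by fun_prop)
    exact (ENNReal.measurable_ofReal.comp hw.measurable).mul
      (ENNReal.measurable_ofReal.comp (hf.comp this).measurable)
  have hdet' : (h • B⁻¹).det = h ^ ℓ * B.det⁻¹ := by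
    rw [Matrix.det_smul, Matrix.det_nonsing_inv, Ring.inverse_eq_inv', Fintype.card_fin]
  have hne : (h • B⁻¹).det ≠ 0 := by
    rw [hdet']
    positivity
  have hker (v : Fin ℓ → ℝ) : ENNReal.ofReal (shearKernel e i₀ w f Y h v) =
      ENNReal.ofReal |B.det|⁻¹ * ψ ((h • B⁻¹).mulVec v - B⁻¹.mulVec (Y i₀)) := by
    have h1 : (h • B⁻¹).mulVec v - B⁻¹.mulVec (Y i₀) = B⁻¹.mulVec (h • v - Y i₀) := by
      rw [Matrix.mulVec_sub, Matrix.mulVec_smul, Matrix.smul_mulVec]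
    have h2 : h⁻¹ • (Y i₀ + B.mulVec (B⁻¹.mulVec (h • v - Y i₀))) = v := by
      rw [Matrix.mulVec_mulVec, Matrix.mul_nonsing_inv _ hBu, Matrix.one_mulVec,
        add_sub_cancel, inv_smul_smul₀ hh.ne']
    simp only [ψ, h1, h2]
    unfold shearKernel
    rw [← hB, mul_comm, ENNReal.ofReal_mul (by positivity),
      ENNReal.ofReal_mul (hw0 _)]
  have hm : Measurable fun v => ψ ((h • B⁻¹).mulVec v - B⁻¹.mulVec (Y i₀)) :=
    hψ.comp (by fun_prop)
  simp only [hker]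
  rw [lintegral_const_mul _ hm, lintegral_mulVec_sub hne _ hψ, ← mul_assoc, ← mul_assoc,
    ← ENNReal.ofReal_mul (by positivity), ← ENNReal.ofReal_mul (by positivity), hdet', mul_inv,
    inv_inv, abs_mul, abs_inv, abs_of_pos (pow_pos hh ℓ)]
  have : h ^ ℓ * |B.det|⁻¹ * ((h ^ ℓ)⁻¹ * |B.det|) = 1 := by
    have := abs_pos.2 hdet
    field_simp
  rw [this, ENNReal.ofReal_one, one_mul]

lemma lintegral_shearKernel_zero (hi₀ : ∀ j, e j ≠ i₀) (hw : Continuous w) (hf : Continuous f)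
    (hw0 : ∀ s, 0 ≤ w s) (hw1 : ∫⁻ s, ENNReal.ofReal (w s) = 1)
    (hfe : tsupport f ⊆ {Y | (rowMinor e Y).det ≠ 0}) {g : Matrix (Fin n) (Fin n) ℝ}
    (hg : g.det = 1) :
    ∫⁻ p : (Fin n → Fin ℓ → ℝ) × (Fin ℓ → ℝ),
        ENNReal.ofReal (shearKernel e i₀ w f (rowAct g p.1) 0 p.2) =
      ∫⁻ Y, ENNReal.ofReal (f Y) := by
  have hK : Continuous fun p : (Fin n → Fin ℓ → ℝ) × (Fin ℓ → ℝ) =>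
      shearKernel e i₀ w f p.1 0 p.2 :=
    (continuous_shearKernel hi₀ hw hf hfe).comp
      (continuous_fst.prodMk (continuous_const.prodMk continuous_snd))
  let K : (Fin n → Fin ℓ → ℝ) × (Fin ℓ → ℝ) → ℝ≥0∞ := fun p =>
    ENNReal.ofReal (shearKernel e i₀ w f p.1 0 p.2)
  have hKm : Measurable K := hK.measurable.ennreal_ofReal
  have hgp : MeasurePreserving (fun p : (Fin n → Fin ℓ → ℝ) × (Fin ℓ → ℝ) =>
      (rowAct g p.1, p.2)) := (measurePreserving_rowAct hg).prod (MeasurePreserving.id volume)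
  refine (hgp.lintegral_comp (f := K) hKm).trans ?_
  refine ((measurePreserving_update_swap i₀).lintegral_comp (f := K) hKm).symm.trans ?_
  have hm : Measurable fun p : (Fin n → Fin ℓ → ℝ) × (Fin ℓ → ℝ) => ENNReal.ofReal
      (shearKernel e i₀ w f (Function.update p.1 i₀ p.2) 0 (p.1 i₀)) :=
    hKm.comp (measurePreserving_update_swap i₀).measurable
  refine (lintegral_prod _ hm.aemeasurable).trans (lintegral_congr fun Y => ?_)
  have hker (v : Fin ℓ → ℝ) : shearKernel e i₀ w f (Function.update Y i₀ v) 0 (Y i₀) =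
      |(rowMinor e Y).det|⁻¹ * f Y * w ((-(rowMinor e Y)⁻¹).mulVec v - 0) := by
    unfold shearKernel
    simp only [rowMinor_update hi₀, Function.update_self, zero_smul, zero_sub,
      Function.update_idem, Function.update_eq_self, Matrix.mulVec_neg, Matrix.neg_mulVec,
      sub_zero]
    ring
  by_cases hdet : (rowMinor e Y).det = 0
  · have h0 : f Y = 0 := image_eq_zero_of_notMem_tsupport fun hmem => hfe hmem hdet
    simp [hker, h0]
  have hdet' : (-(rowMinor e Y)⁻¹).det = (-1) ^ ℓ * (rowMinor e Y).det⁻¹ := by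
    rw [Matrix.det_neg, Matrix.det_nonsing_inv, Ring.inverse_eq_inv', Fintype.card_fin]
  have hne : (-(rowMinor e Y)⁻¹).det ≠ 0 := by
    rw [hdet']
    exact mul_ne_zero (by simp) (inv_ne_zero hdet)
  have hofReal (v : Fin ℓ → ℝ) :
      ENNReal.ofReal (shearKernel e i₀ w f (Function.update Y i₀ v) 0 (Y i₀)) =
      ENNReal.ofReal (|(rowMinor e Y).det|⁻¹ * f Y) *
        ENNReal.ofReal (w ((-(rowMinor e Y)⁻¹).mulVec v - 0)) := by
    rw [hker, ENNReal.ofReal_mul' (hw0 _)]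
  have hwm : Measurable fun s => ENNReal.ofReal (w s) :=
    ENNReal.measurable_ofReal.comp hw.measurable
  have hwm' : Measurable fun v =>
      ENNReal.ofReal (w ((-(rowMinor e Y)⁻¹).mulVec v - 0)) := hwm.comp (by fun_prop)
  simp only [hofReal]
  rw [lintegral_const_mul _ hwm', lintegral_mulVec_sub hne 0 hwm, hw1, mul_one,
    ← ENNReal.ofReal_mul' (abs_nonneg _), hdet', mul_inv, abs_mul, inv_inv, abs_inv, abs_pow,
    abs_neg, abs_one, one_pow, inv_one, one_mul]
  congr 1
  have := abs_pos.2 hdet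
  field_simp

/-- Averages over shears of the sums of `f` over the points of a unimodular lattice converge to
the integral of `f`. -/
lemma tendsto_tsum_shearKernel (hi₀ : ∀ j, e j ≠ i₀) (hw : Continuous w) (hf : Continuous f)
    (hwc : HasCompactSupport w) (hfc : HasCompactSupport f)
    (hw0 : ∀ s, 0 ≤ w s) (hw1 : ∫⁻ s, ENNReal.ofReal (w s) = 1)
    (hfe : tsupport f ⊆ {Y | (rowMinor e Y).det ≠ 0}) {g : Matrix (Fin n) (Fin n) ℝ}
    (hg : g.det = 1) {ε : ℕ → ℝ} (hε : ∀ k, ε k ∈ Set.Ioc (0 : ℝ) 1)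
    (hε0 : Tendsto ε atTop (𝓝 0)) :
    Tendsto (fun k => ENNReal.ofReal (ε k ^ (n * ℓ)) * ∑' M : Fin n → Fin ℓ → ℤ,
        ∫⁻ v, ENNReal.ofReal
          (shearKernel e i₀ w f (rowAct g (ε k • castMat M)) (ε k ^ n) v)) atTop
      (𝓝 (∫⁻ Y, ENNReal.ofReal (f Y))) := by
  have hn : n ≠ 0 := fun hn => by subst hn; exact i₀.elim0
  have hK := continuous_shearKernel hi₀ hw hf hfe
  have hgc : Continuous (rowAct g : (Fin n → Fin ℓ → ℝ) → _) :=
    continuous_rowAct.comp (f := fun X => (g, X)) (by fun_prop)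
  obtain ⟨R, hR⟩ := exists_bound_of_shearKernel_ne_zero (w := w) (f := f) hi₀ hwc hfc
  obtain ⟨C, hC⟩ := ((isCompact_closedBall (0 : Fin n → Fin ℓ → ℝ) R).prod
    ((isCompact_Icc (a := (0 : ℝ)) (b := 1)).prod
      (isCompact_closedBall (0 : Fin ℓ → ℝ) R))).exists_bound_of_continuousOn hK.continuousOn
  obtain ⟨R', hR'⟩ : ∃ R', ∀ Y : Fin n → Fin ℓ → ℝ, ‖rowAct g Y‖ ≤ R → ‖Y‖ ≤ R' := by
    have hc : Continuous (rowAct g⁻¹ : (Fin n → Fin ℓ → ℝ) → _) :=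
      continuous_rowAct.comp (f := fun X => (g⁻¹, X)) (by fun_prop)
    obtain ⟨R', h⟩ := ((isCompact_closedBall (0 : Fin n → Fin ℓ → ℝ) R).image
      hc).isBounded.exists_norm_le
    refine ⟨R', fun Y hY => h Y ⟨rowAct g Y, by simpa using hY, ?_⟩⟩
    rw [← rowAct_mul, Matrix.nonsing_inv_mul _ (by simp [hg]), rowAct_one]
  let P := (Fin n → Fin ℓ → ℝ) × (Fin ℓ → ℝ)
  let y (k : ℕ) (Y : Fin n → Fin ℓ → ℝ) : Fin n → Fin ℓ → ℝ :=
    ε k • castMat (floorMat ((ε k)⁻¹ • Y))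
  have hy (k : ℕ) : Measurable (y k) := by
    have : Measurable (castMat : (Fin n → Fin ℓ → ℤ) → _) := measurable_of_countable _
    exact (this.comp (measurable_floorMat.comp (measurable_const_smul ((ε k)⁻¹)))).const_smul (ε k)
  let F (k : ℕ) (p : P) : ℝ≥0∞ :=
    ENNReal.ofReal (shearKernel e i₀ w f (rowAct g (y k p.1)) (ε k ^ n) p.2)
  have hFm (k : ℕ) : Measurable (F k) := by
    have h1 : Measurable fun p : P => rowAct g (y k p.1) :=
      hgc.measurable.comp ((hy k).comp measurable_fst)
    have h2 : Measurable fun p : P => (rowAct g (y k p.1), ε k ^ n, p.2) :=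
      h1.prodMk (measurable_const.prodMk measurable_snd)
    exact (hK.measurable.comp h2).ennreal_ofReal
  have hεn (k : ℕ) : ε k ^ n ∈ Set.Icc (0 : ℝ) 1 :=
    ⟨pow_nonneg (hε k).1.le n, pow_le_one₀ (hε k).1.le (hε k).2⟩
  let bound : P → ℝ≥0∞ := (Metric.closedBall 0 (R' + 1) ×ˢ Metric.closedBall 0 R).indicator
    fun _ => ENNReal.ofReal C
  have hbound (k : ℕ) : F k ≤ bound := by
    intro p
    by_cases h0 : shearKernel e i₀ w f (rowAct g (y k p.1)) (ε k ^ n) p.2 = 0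
    · simp [F, h0]
    obtain ⟨h1, h2⟩ := hR _ _ _ (hεn k) h0
    have hp : p ∈ (Metric.closedBall 0 (R' + 1) ×ˢ Metric.closedBall 0 R : Set P) := by
      refine ⟨?_, by simpa using h2⟩
      have h3 := norm_smul_floorMat_sub_le (hε k).1 p.1
      have h4 := hR' _ h1
      have h5 : ‖p.1‖ ≤ ‖y k p.1‖ + ‖y k p.1 - p.1‖ := by
        simpa using norm_sub_le (y k p.1) (y k p.1 - p.1)
      simpa using h5.trans (add_le_add h4 (h3.trans (hε k).2))
    simp only [bound, Set.indicator_of_mem hp, F]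
    exact ENNReal.ofReal_le_ofReal ((le_abs_self _).trans
      (hC (rowAct g (y k p.1), ε k ^ n, p.2)
        ⟨mem_closedBall_zero_iff.2 h1, hεn k, mem_closedBall_zero_iff.2 h2⟩))
  have hfin : ∫⁻ p, bound p ≠ ⊤ := by
    rw [lintegral_indicator
      (Metric.isClosed_closedBall.prod Metric.isClosed_closedBall).measurableSet,
      setLIntegral_const]
    refine ENNReal.mul_ne_top ENNReal.ofReal_ne_top ?_
    exact ((isCompact_closedBall _ _).prod (isCompact_closedBall _ _)).measure_lt_top.ne
  have hlim (p : P) : Tendsto (fun k => F k p) atTop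
      (𝓝 (ENNReal.ofReal (shearKernel e i₀ w f (rowAct g p.1) 0 p.2))) := by
    refine ENNReal.tendsto_ofReal ?_
    have hyl : Tendsto (fun k => y k p.1) atTop (𝓝 p.1) := by
      rw [tendsto_iff_norm_sub_tendsto_zero]
      exact squeeze_zero (fun _ => norm_nonneg _)
        (fun k => norm_smul_floorMat_sub_le (hε k).1 p.1) hε0
    have h1 : Tendsto (fun k => ε k ^ n) atTop (𝓝 0) := by simpa [hn] using hε0.pow n
    have h2 : Tendsto (fun k => (rowAct g (y k p.1), ε k ^ n, p.2)) atTop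
        (𝓝 (rowAct g p.1, 0, p.2)) :=
      ((hgc.tendsto p.1).comp hyl).prodMk_nhds (h1.prodMk_nhds tendsto_const_nhds)
    exact (hK.tendsto (rowAct g p.1, 0, p.2)).comp h2
  have key := tendsto_lintegral_of_dominated_convergence bound hFm
    (fun k => Eventually.of_forall (hbound k)) hfin (Eventually.of_forall hlim)
  rw [lintegral_shearKernel_zero hi₀ hw hf hw0 hw1 hfe hg] at key
  refine key.congr fun k => ?_
  rw [← lintegral_floorMat_inv_smul (hε k).1]
  exact lintegral_prod _ (hFm k).aemeasurable

end Kernel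

section Lattice

variable {n ℓ : ℕ}

attribute [local irreducible] shearKernel rowAct

instance : IsTopologicalGroup (SLR n) := Matrix.SpecialLinearGroup.topologicalGroup

instance : BorelSpace (LatticeSpace n) := ⟨rfl⟩

instance : ContinuousSMul (SLR n) (LatticeSpace n) :=
  inferInstanceAs (ContinuousSMul (SLR n) (SLR n ⧸ SLZ n))

/-- The lattice spanned by the columns of `g`. -/
def latticeMk (g : SLR n) : LatticeSpace n := (QuotientGroup.mk g : SLR n ⧸ SLZ n)

lemma isQuotientMap_latticeMk : IsQuotientMap (latticeMk : SLR n → LatticeSpace n) :=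
  QuotientGroup.isQuotientMap_mk (N := SLZ n)

lemma smul_latticeMk (u g : SLR n) : u • latticeMk g = latticeMk (u * g) := rfl

/-- The sum of `f` over all `ℓ`-tuples of points of the lattice `L`. -/
def latticeSum (f : (Fin n → Fin ℓ → ℝ) → ℝ≥0∞) (L : LatticeSpace n) : ℝ≥0∞ :=
  ∑' M : Fin n → Fin ℓ → ℤ, f (rowAct (Quotient.out (α := SLR n) L).1 (castMat M))

lemma latticeSum_mk (f : (Fin n → Fin ℓ → ℝ) → ℝ≥0∞) (g : SLR n) :
    latticeSum f (latticeMk g) = ∑' M, f (rowAct g.1 (castMat M)) := by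
  obtain ⟨⟨_, γ, rfl⟩, hγ⟩ := QuotientGroup.mk_out_eq_mul (SLZ n) g
  let δ : Matrix.SpecialLinearGroup (Fin n) ℤ := γ⁻¹
  have hδγ : (δ : Matrix (Fin n) (Fin n) ℤ) * γ = 1 := by
    rw [← Matrix.SpecialLinearGroup.coe_mul, inv_mul_cancel, Matrix.SpecialLinearGroup.coe_one]
  have hγδ : (γ : Matrix (Fin n) (Fin n) ℤ) * δ = 1 := by
    rw [← Matrix.SpecialLinearGroup.coe_mul, mul_inv_cancel, Matrix.SpecialLinearGroup.coe_one]
  let τ (A : Matrix (Fin n) (Fin n) ℤ) (M : Matrix (Fin n) (Fin ℓ) ℤ) : Fin n → Fin ℓ → ℤ := A * M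
  have hτ (A B : Matrix (Fin n) (Fin n) ℤ) (hAB : A * B = 1) (M : Fin n → Fin ℓ → ℤ) :
      τ A (τ B M) = M := by
    have h : A * (B * Matrix.of M) = Matrix.of M := by
      rw [← Matrix.mul_assoc, hAB, Matrix.one_mul]
    exact h
  let σ : (Fin n → Fin ℓ → ℤ) ≃ (Fin n → Fin ℓ → ℤ) := ⟨τ γ, τ δ, hτ _ _ hδγ, hτ _ _ hγδ⟩
  have hσ (M : Fin n → Fin ℓ → ℤ) :
      rowAct (Matrix.SpecialLinearGroup.map (Int.castRingHom ℝ) γ).1 (castMat M) =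
        castMat (σ M) := by
    ext i j
    change _ = (((γ.1 * Matrix.of M) i j : ℤ) : ℝ)
    simp [rowAct_apply, castMat, Matrix.mul_apply]
  have hout : Quotient.out (α := SLR n) (latticeMk g) =
      g * Matrix.SpecialLinearGroup.map (Int.castRingHom ℝ) γ := hγ
  rw [latticeSum, hout, ← σ.tsum_eq fun M => f (rowAct g.1 (castMat M))]
  refine tsum_congr fun M => ?_
  rw [Matrix.SpecialLinearGroup.coe_mul, rowAct_mul, hσ]

lemma lowerSemicontinuous_latticeSum {f : (Fin n → Fin ℓ → ℝ) → ℝ≥0∞}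
    (hf : LowerSemicontinuous f) : LowerSemicontinuous (latticeSum f) := by
  have h : LowerSemicontinuous fun g : SLR n => latticeSum f (latticeMk g) := by
    simp only [latticeSum_mk]
    refine lowerSemicontinuous_tsum fun M => hf.comp ?_
    have hc : Continuous fun g : SLR n => (g.1, castMat M) :=
      continuous_induced_dom.prodMk continuous_const
    exact continuous_rowAct.comp hc
  rw [lowerSemicontinuous_iff_isOpen_preimage] at h ⊢
  exact fun a => isQuotientMap_latticeMk.isOpen_preimage.1 (h a)

lemma measurable_latticeSum {f : (Fin n → Fin ℓ → ℝ) → ℝ≥0∞}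
    (hf : LowerSemicontinuous f) : Measurable (latticeSum f) :=
  (lowerSemicontinuous_latticeSum hf).measurable

lemma det_shear {e : Fin ℓ → Fin n} {i₀ : Fin n} (hi₀ : ∀ j, e j ≠ i₀) {ε : ℝ} (hε : ε ≠ 0)
    (s : Fin ℓ → ℝ) :
    ((ε • (1 : Matrix (Fin n) (Fin n) ℝ)).updateRow i₀ (((ε ^ n)⁻¹ * ε) •
      (Pi.single i₀ 1 + ∑ j, s j • Pi.single (e j) 1))).det = 1 := by
  have hn : n ≠ 0 := fun hn => by subst hn; exact i₀.elim0
  obtain ⟨m, rfl⟩ := Nat.exists_eq_succ_of_ne_zero hn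
  rw [← Matrix.cramer_transpose_apply, Matrix.transpose_smul, Matrix.transpose_one,
    Matrix.cramer_smul, Matrix.cramer_one]
  have h0 : ∑ j, s j * (Pi.single (e j) 1 : Fin (m + 1) → ℝ) i₀ = 0 :=
    Finset.sum_eq_zero fun j _ => by simp [(hi₀ j).symm]
  simp [h0, pow_succ]
  field_simp

/-- A scaled shear adding multiples of the rows selected by `e` to the row `i₀`. -/
def shear {e : Fin ℓ → Fin n} {i₀ : Fin n} (hi₀ : ∀ j, e j ≠ i₀) {ε : ℝ} (hε : ε ≠ 0)
    (s : Fin ℓ → ℝ) : SLR n :=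
  ⟨_, det_shear hi₀ hε s⟩

variable {e : Fin ℓ → Fin n} {i₀ : Fin n} {w : (Fin ℓ → ℝ) → ℝ} {f : (Fin n → Fin ℓ → ℝ) → ℝ}

lemma continuous_shear (hi₀ : ∀ j, e j ≠ i₀) {ε : ℝ} (hε : ε ≠ 0) :
    Continuous (shear hi₀ hε) := by
  refine continuous_induced_rng.2 ?_
  change Continuous fun s : Fin ℓ → ℝ => Matrix.updateRow _ _ _
  exact continuous_const.matrix_updateRow _ (by fun_prop)

lemma rowAct_shear (hi₀ : ∀ j, e j ≠ i₀) {ε : ℝ} (hε : ε ≠ 0) (s : Fin ℓ → ℝ)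
    (X : Fin n → Fin ℓ → ℝ) :
    rowAct (shear hi₀ hε s).1 X = Function.update (ε • X) i₀
      ((ε ^ n)⁻¹ • ((ε • X) i₀ + (rowMinor e (ε • X)).mulVec s)) := by
  rw [rowMinor_mulVec]
  ext i j
  rw [rowAct_apply]
  by_cases hi : i = i₀
  · subst hi
    simp only [shear, Matrix.updateRow_self, Function.update_self, Pi.smul_apply, Pi.add_apply,
      Finset.sum_apply, smul_eq_mul, add_mul, mul_add, Finset.sum_add_distrib, Finset.mul_sum,
      Finset.sum_mul]
    rw [Finset.sum_comm]
    simp [Pi.single_apply, mul_assoc, mul_left_comm]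
  · simp [shear, hi, Matrix.one_apply]

lemma lintegral_shear_smul (hi₀ : ∀ j, e j ≠ i₀) (hw : Continuous w) (hf : Continuous f)
    (hw0 : ∀ s, 0 ≤ w s) (hfe : tsupport f ⊆ {Y | (rowMinor e Y).det ≠ 0}) (g : SLR n) {ε : ℝ}
    (hε : 0 < ε) :
    ∫⁻ s, ENNReal.ofReal (w s) *
        latticeSum (fun Y => ENNReal.ofReal (f Y)) (shear hi₀ hε.ne' s • latticeMk g) =
      ENNReal.ofReal (ε ^ (n * ℓ)) * ∑' M : Fin n → Fin ℓ → ℤ,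
        ∫⁻ v, ENNReal.ofReal
          (shearKernel e i₀ w f (rowAct g.1 (ε • castMat M)) (ε ^ n) v) := by
  simp only [smul_latticeMk, latticeSum_mk, ← ENNReal.tsum_mul_left]
  have hm (M : Fin n → Fin ℓ → ℤ) : Measurable fun s => ENNReal.ofReal (w s) *
      ENNReal.ofReal (f (rowAct (shear hi₀ hε.ne' s * g).1 (castMat M))) := by
    have hc : Continuous fun s => rowAct (shear hi₀ hε.ne' s * g).1 (castMat M) := by
      have h1 : Continuous fun s => (shear hi₀ hε.ne' s * g).1 :=
        continuous_induced_dom.comp ((continuous_shear hi₀ hε.ne').mul continuous_const)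
      exact continuous_rowAct.comp (h1.prodMk continuous_const)
    exact hw.measurable.ennreal_ofReal.mul (hf.comp hc).measurable.ennreal_ofReal
  rw [lintegral_tsum fun M => (hm M).aemeasurable]
  refine tsum_congr fun M => ?_
  rw [pow_mul, ← lintegral_shear hi₀ hw hf hw0 hfe _ (pow_pos hε n), rowAct_smul]
  simp only [Matrix.SpecialLinearGroup.coe_mul, rowAct_mul, rowAct_shear]

/-- A weight for averaging. -/
lemma exists_weight (ℓ : ℕ) : ∃ w : (Fin ℓ → ℝ) → ℝ, Continuous w ∧ HasCompactSupport w ∧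
    (∀ s, 0 ≤ w s) ∧ ∫⁻ s, ENNReal.ofReal (w s) = 1 := by
  let b : ContDiffBump (0 : Fin ℓ → ℝ) := ⟨1, 2, one_pos, one_lt_two⟩
  refine ⟨b.normed volume, b.continuous_normed, b.hasCompactSupport_normed, b.nonneg_normed, ?_⟩
  rw [← ofReal_integral_eq_lintegral_ofReal b.integrable_normed
    (Eventually.of_forall b.nonneg_normed), b.integral_normed, ENNReal.ofReal_one]

lemma lintegral_min_latticeSum_le {μ : Measure (LatticeSpace n)} [IsProbabilityMeasure μ]
    (hinv : ∀ g : SLR n, Measure.map (fun x => g • x) μ = μ)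
    (hi₀ : ∀ j, e j ≠ i₀) (hf : Continuous f) (hfc : HasCompactSupport f)
    (hfe : tsupport f ⊆ {Y | (rowMinor e Y).det ≠ 0}) (m : ℕ) :
    ∫⁻ L, min (latticeSum (fun Y => ENNReal.ofReal (f Y)) L) m ∂μ ≤
      ∫⁻ Y, ENNReal.ofReal (f Y) := by
  obtain ⟨w, hw, hwc, hw0, hw1⟩ := exists_weight ℓ
  let F : LatticeSpace n → ℝ≥0∞ := latticeSum fun Y => ENNReal.ofReal (f Y)
  have hF : Measurable F :=
    measurable_latticeSum (ENNReal.continuous_ofReal.comp hf).lowerSemicontinuous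
  let ε (k : ℕ) : ℝ := 1 / ((k : ℝ) + 1)
  have hεpos (k : ℕ) : 0 < ε k := Nat.one_div_pos_of_nat
  have hε (k : ℕ) : ε k ∈ Set.Ioc (0 : ℝ) 1 :=
    ⟨hεpos k, (div_le_one (by positivity)).2 (by simp)⟩
  have hε0 : Tendsto ε atTop (𝓝 0) := tendsto_one_div_add_atTop_nhds_zero_nat
  let u (k : ℕ) (s : Fin ℓ → ℝ) : SLR n := shear hi₀ (hεpos k).ne' s
  have hwm : Measurable fun s => ENNReal.ofReal (w s) := hw.measurable.ennreal_ofReal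
  have hact (k : ℕ) : Measurable fun p : (Fin ℓ → ℝ) × LatticeSpace n => F (u k p.1 • p.2) := by
    have hc : Continuous fun p : (Fin ℓ → ℝ) × LatticeSpace n => u k p.1 • p.2 :=
      ((continuous_shear hi₀ (hεpos k).ne').comp continuous_fst).smul continuous_snd
    exact hF.comp hc.measurable
  let A (k : ℕ) (L : LatticeSpace n) : ℝ≥0∞ :=
    ∫⁻ s, ENNReal.ofReal (w s) * F (u k s • L)
  have hA (k : ℕ) : Measurable (A k) :=
    ((hwm.comp measurable_fst).mul (hact k)).lintegral_prod_left'
  have hAlim (L : LatticeSpace n) :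
      Tendsto (fun k => A k L) atTop (𝓝 (∫⁻ Y, ENNReal.ofReal (f Y))) := by
    obtain ⟨g, rfl⟩ := isQuotientMap_latticeMk.surjective L
    refine (tendsto_tsum_shearKernel hi₀ hw hf hwc hfc hw0 hw1 hfe g.2 hε hε0).congr fun k => ?_
    exact (lintegral_shear_smul hi₀ hw hf hw0 hfe g (hεpos k)).symm
  have hle (k : ℕ) : ∫⁻ L, min (F L) m ∂μ ≤ ∫⁻ L, min (A k L) m ∂μ := by
    calc ∫⁻ L, min (F L) m ∂μ
        = ∫⁻ s, ENNReal.ofReal (w s) * ∫⁻ L, min (F L) m ∂μ := by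
          rw [lintegral_mul_const _ hwm, hw1, one_mul]
      _ = ∫⁻ s, ∫⁻ L, ENNReal.ofReal (w s) * min (F (u k s • L)) m ∂μ := by
          refine lintegral_congr fun s => ?_
          have hs : Measurable fun L : LatticeSpace n => u k s • L :=
            (continuous_const_smul _).measurable
          conv_lhs => rw [← hinv (u k s)]
          have hm : Measurable fun L => min (F (u k s • L)) m :=
            (hF.comp hs).min measurable_const
          rw [lintegral_map (hF.min measurable_const) hs, lintegral_const_mul _ hm]
      _ = ∫⁻ L, ∫⁻ s, ENNReal.ofReal (w s) * min (F (u k s • L)) m ∂volume ∂μ :=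
          lintegral_lintegral_swap
            ((hwm.comp measurable_fst).mul ((hact k).min measurable_const)).aemeasurable
      _ ≤ ∫⁻ L, min (A k L) m ∂μ := by
          refine lintegral_mono fun L => le_min ?_ ?_
          · exact lintegral_mono fun s => by gcongr; exact min_le_left _ _
          · calc ∫⁻ s, ENNReal.ofReal (w s) * min (F (u k s • L)) m
                ≤ ∫⁻ s, ENNReal.ofReal (w s) * m :=
                  lintegral_mono fun s => by gcongr; exact min_le_right _ _
              _ = m := by rw [lintegral_mul_const _ hwm, hw1, one_mul]
  have hlim : Tendsto (fun k => ∫⁻ L, min (A k L) m ∂μ) atTop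
      (𝓝 (∫⁻ _, min (∫⁻ Y, ENNReal.ofReal (f Y)) m ∂μ)) :=
    tendsto_lintegral_of_dominated_convergence (fun _ => (m : ℝ≥0∞))
      (fun k => (hA k).min measurable_const)
      (fun k => Eventually.of_forall fun L => min_le_right _ _) (by simp)
      (Eventually.of_forall fun L => (hAlim L).min tendsto_const_nhds)
  have h := ge_of_tendsto' hlim hle
  rw [lintegral_const, measure_univ, mul_one] at h
  exact h.trans (min_le_left _ _)

lemma lintegral_latticeSum_le {μ : Measure (LatticeSpace n)} [IsProbabilityMeasure μ]
    (hinv : ∀ g : SLR n, Measure.map (fun x => g • x) μ = μ)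
    (hi₀ : ∀ j, e j ≠ i₀) (hf : Continuous f) (hfc : HasCompactSupport f)
    (hfe : tsupport f ⊆ {Y | (rowMinor e Y).det ≠ 0}) :
    ∫⁻ L, latticeSum (fun Y => ENNReal.ofReal (f Y)) L ∂μ ≤ ∫⁻ Y, ENNReal.ofReal (f Y) := by
  have hF : Measurable (latticeSum fun Y => ENNReal.ofReal (f Y) : LatticeSpace n → ℝ≥0∞) :=
    measurable_latticeSum (ENNReal.continuous_ofReal.comp hf).lowerSemicontinuous
  have hsup (x : ℝ≥0∞) : x = ⨆ m : ℕ, min x m := by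
    rw [← inf_iSup_eq, ENNReal.iSup_natCast, inf_top_eq]
  calc ∫⁻ L, latticeSum (fun Y => ENNReal.ofReal (f Y)) L ∂μ
      = ∫⁻ L, ⨆ m : ℕ, min (latticeSum (fun Y => ENNReal.ofReal (f Y)) L) m ∂μ :=
        lintegral_congr fun L => hsup _
    _ = ⨆ m : ℕ, ∫⁻ L, min (latticeSum (fun Y => ENNReal.ofReal (f Y)) L) m ∂μ :=
        lintegral_iSup (fun m => hF.min measurable_const)
          fun a b hab L => min_le_min_left _ (by exact_mod_cast hab)
    _ ≤ _ := iSup_le fun m => lintegral_min_latticeSum_le hinv hi₀ hf hfc hfe m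

end Lattice

section Counting

variable {n ℓ : ℕ}

lemma exists_continuous_seq_of_isOpen {V : Set (Fin n → Fin ℓ → ℝ)} (hV : IsOpen V) :
    ∃ f : ℕ → (Fin n → Fin ℓ → ℝ) → ℝ, (∀ k, Continuous (f k)) ∧
      (∀ k, HasCompactSupport (f k)) ∧ (∀ k, tsupport (f k) ⊆ V) ∧
      (∀ k Y, ENNReal.ofReal (f k Y) ≤ V.indicator 1 Y) ∧
      ∀ Y, V.indicator 1 Y ≤ liminf (fun k => ENNReal.ofReal (f k Y)) atTop := by
  obtain ⟨F, hFc, hFV, hF, hFm⟩ := hV.exists_iUnion_isClosed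
  have hcpt (k : ℕ) : IsCompact (F k ∩ Metric.closedBall 0 k) :=
    (isCompact_closedBall _ _).inter_left (hFc k)
  choose f hf1 hfc hft hf01 using fun k => exists_continuousMap_one_of_isCompact_subset_isOpen
    (hcpt k) hV (Set.inter_subset_left.trans (hFV k))
  refine ⟨fun k => f k, fun k => (f k).continuous, hfc, hft, fun k Y => ?_, fun Y => ?_⟩
  · by_cases hY : Y ∈ V
    · simpa [hY] using (hf01 k Y).2
    · simp [image_eq_zero_of_notMem_tsupport fun h => hY (hft k h)]
  · by_cases hY : Y ∈ V
    · obtain ⟨a, ha⟩ := Set.mem_iUnion.1 (hF ▸ hY)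
      obtain ⟨b, hb⟩ := exists_nat_ge ‖Y‖
      refine le_liminf_of_le (by isBoundedDefault) ?_
      filter_upwards [eventually_ge_atTop (max a b)] with k hk
      have hk' : Y ∈ F k ∩ Metric.closedBall 0 k :=
        ⟨hFm ((le_max_left a b).trans hk) ha, mem_closedBall_zero_iff.2
          (hb.trans (by exact_mod_cast (le_max_right a b).trans hk))⟩
      simp [hY, hf1 k hk']
    · simp [hY]

lemma latticeSum_mono {f g : (Fin n → Fin ℓ → ℝ) → ℝ≥0∞} (h : f ≤ g) :
    latticeSum f ≤ latticeSum g :=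
  fun _ => ENNReal.tsum_le_tsum fun _ => h _

lemma latticeSum_liminf_le (f : ℕ → (Fin n → Fin ℓ → ℝ) → ℝ≥0∞) (L : LatticeSpace n) :
    latticeSum (fun Y => liminf (fun k => f k Y) atTop) L ≤
      liminf (fun k => latticeSum (f k) L) atTop := by
  simp only [latticeSum, ← lintegral_count]
  exact lintegral_liminf_le fun k => measurable_of_countable _

lemma lintegral_latticeSum_indicator_le {μ : Measure (LatticeSpace n)} [IsProbabilityMeasure μ]
    (hinv : ∀ g : SLR n, Measure.map (fun x => g • x) μ = μ) {e : Fin ℓ → Fin n} {i₀ : Fin n}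
    (hi₀ : ∀ j, e j ≠ i₀) {V : Set (Fin n → Fin ℓ → ℝ)} (hV : IsOpen V)
    (hVe : V ⊆ {Y | (rowMinor e Y).det ≠ 0}) :
    ∫⁻ L, latticeSum (V.indicator 1) L ∂μ ≤ volume V := by
  obtain ⟨f, hf, hfc, hft, hfV, hVf⟩ := exists_continuous_seq_of_isOpen hV
  calc ∫⁻ L, latticeSum (V.indicator 1) L ∂μ
      ≤ ∫⁻ L, liminf (fun k => latticeSum (fun Y => ENNReal.ofReal (f k Y)) L) atTop ∂μ :=
        lintegral_mono fun L => (latticeSum_mono hVf L).trans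
          (latticeSum_liminf_le (fun k Y => ENNReal.ofReal (f k Y)) L)
    _ ≤ liminf (fun k => ∫⁻ L, latticeSum (fun Y => ENNReal.ofReal (f k Y)) L ∂μ) atTop :=
        lintegral_liminf_le fun k =>
          measurable_latticeSum (ENNReal.continuous_ofReal.comp (hf k)).lowerSemicontinuous
    _ ≤ volume V := by
        refine liminf_le_of_frequently_le' (Frequently.of_forall fun k => ?_)
        refine (lintegral_latticeSum_le hinv hi₀ (hf k) (hfc k) ((hft k).trans hVe)).trans ?_
        rw [← lintegral_indicator_one hV.measurableSet]
        exact lintegral_mono (hfV k)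

/-- The expected number of linearly independent tuples of lattice points in `A` is at most the
volume of `A`, up to replacing the indicator function by a semicontinuous majorant. -/
lemma exists_lowerSemicontinuous_latticeSum_le {μ : Measure (LatticeSpace n)}
    [IsProbabilityMeasure μ] (hinv : ∀ g : SLR n, Measure.map (fun x => g • x) μ = μ)
    (hℓ : ℓ < n) {A : Set (Fin n → Fin ℓ → ℝ)} (hA : MeasurableSet A) {δ : ℝ≥0∞} (hδ : δ ≠ 0) :
    ∃ G : (Fin n → Fin ℓ → ℝ) → ℝ≥0∞, LowerSemicontinuous G ∧
      (∀ X ∈ A, (∃ e : Fin ℓ → Fin n, (rowMinor e X).det ≠ 0) → 1 ≤ G X) ∧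
      ∫⁻ L, latticeSum G L ∂μ ≤ volume A + δ := by
  have : Nonempty (Fin n) := ⟨⟨ℓ, hℓ⟩⟩
  have : (volume : Measure (Fin n → Fin ℓ → ℝ)).Regular :=
    Measure.Regular.of_sigmaCompactSpace_of_isLocallyFiniteMeasure _
  obtain ⟨t, ht⟩ := exists_surjective_nat (Fin ℓ → Fin n)
  let U (k : ℕ) : Set (Fin n → Fin ℓ → ℝ) := {Y | (rowMinor (t k) Y).det ≠ 0}
  have hU (k : ℕ) : IsOpen (U k) :=
    isOpen_ne_fun (continuous_rowMinor (t k)).matrix_det continuous_const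
  let D : ℕ → Set (Fin n → Fin ℓ → ℝ) := disjointed fun k => A ∩ U k
  have hD (k : ℕ) : MeasurableSet (D k) :=
    MeasurableSet.disjointed (fun k => hA.inter (hU k).measurableSet) k
  have hDsub (k : ℕ) : D k ⊆ A ∩ U k := disjointed_subset _ k
  obtain ⟨η, hη, hηδ⟩ := ENNReal.exists_pos_sum_of_countable' hδ ℕ
  choose W hDW hW hWD using fun k => (D k).exists_isOpen_le_add volume (hη k).ne'
  let V (k : ℕ) : Set (Fin n → Fin ℓ → ℝ) := W k ∩ U k
  have hV (k : ℕ) : IsOpen (V k) := (hW k).inter (hU k)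
  have hlsc (k : ℕ) : LowerSemicontinuous ((V k).indicator (1 : (Fin n → Fin ℓ → ℝ) → ℝ≥0∞)) :=
    (hV k).lowerSemicontinuous_indicator zero_le_one
  have hint (k : ℕ) : ∫⁻ L, latticeSum ((V k).indicator 1) L ∂μ ≤ volume (D k) + η k := by
    obtain ⟨i₀, hi₀⟩ : ∃ i₀, ∀ j, t k j ≠ i₀ := by
      by_contra! h
      exact absurd (Fintype.card_le_of_surjective _ h) (by simpa using hℓ)
    exact (lintegral_latticeSum_indicator_le hinv hi₀ (hV k) Set.inter_subset_right).trans
      ((measure_mono Set.inter_subset_left).trans (hWD k))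
  refine ⟨fun X => ∑' k, (V k).indicator 1 X, lowerSemicontinuous_tsum hlsc,
    fun X hX ⟨e, he⟩ => ?_, ?_⟩
  · obtain ⟨k, rfl⟩ := ht e
    have : X ∈ ⋃ k, D k := by
      rw [iUnion_disjointed]
      exact Set.mem_iUnion.2 ⟨k, hX, he⟩
    obtain ⟨m, hm⟩ := Set.mem_iUnion.1 this
    have hmV : X ∈ V m := ⟨hDW m hm, (hDsub m hm).2⟩
    calc (1 : ℝ≥0∞) = (V m).indicator 1 X := by simp [hmV]
      _ ≤ _ := ENNReal.le_tsum m
  · calc ∫⁻ L, latticeSum (fun X => ∑' k, (V k).indicator 1 X) L ∂μ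
        = ∫⁻ L, ∑' k, latticeSum ((V k).indicator 1) L ∂μ :=
          lintegral_congr fun L => ENNReal.tsum_comm
      _ = ∑' k, ∫⁻ L, latticeSum ((V k).indicator 1) L ∂μ :=
          lintegral_tsum fun k => (measurable_latticeSum (hlsc k)).aemeasurable
      _ ≤ ∑' k, (volume (D k) + η k) := ENNReal.tsum_le_tsum hint
      _ = volume (⋃ k, D k) + ∑' k, η k := by
          rw [ENNReal.tsum_add, measure_iUnion (disjoint_disjointed _) hD]
      _ ≤ volume A + δ := by
          gcongr
          exact Set.iUnion_subset fun k => (hDsub k).trans Set.inter_subset_left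

lemma exists_det_rowMinor_ne_zero {X : Fin n → Fin ℓ → ℝ}
    (hX : LinearIndependent ℝ fun (j : Fin ℓ) (i : Fin n) => X i j) :
    ∃ e : Fin ℓ → Fin n, (rowMinor e X).det ≠ 0 := by
  obtain ⟨κ, a, ha, hspan, hli⟩ := exists_linearIndependent' ℝ X
  have : Fintype κ := Fintype.ofInjective a ha
  have hrank : (Matrix.of X).rank = ℓ := by
    rw [← Matrix.rank_transpose]
    simpa using LinearIndependent.rank_matrix (M := (Matrix.of X).transpose) hX
  have hcard : Fintype.card κ = ℓ := by
    rw [← finrank_span_eq_card hli, hspan]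
    exact (Matrix.rank_eq_finrank_span_row (Matrix.of X)).symm.trans hrank
  let φ : Fin ℓ ≃ κ := (Fintype.equivFinOfCardEq hcard).symm
  refine ⟨a ∘ φ, ?_⟩
  have h : IsUnit (rowMinor (a ∘ φ) X).transpose :=
    Matrix.linearIndependent_rows_iff_isUnit.1 (hli.comp φ φ.injective)
  simpa using (Matrix.isUnit_iff_isUnit_det _).1 h

lemma factorial_le_latticeSum {S : Set (Fin n → ℝ)} {G : (Fin n → Fin ℓ → ℝ) → ℝ≥0∞}
    (hG : ∀ X : Fin n → Fin ℓ → ℝ, (∀ j, (fun i => X i j) ∈ S) →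
      (∃ e : Fin ℓ → Fin n, (rowMinor e X).det ≠ 0) → 1 ≤ G X)
    {L : LatticeSpace n} {X : Set (Fin n → ℝ)} (hXS : X ⊆ latticeOf L ∩ S) (hXfin : X.Finite)
    (hcard : X.ncard = ℓ) (hX : indepSet X) :
    (ℓ.factorial : ℝ≥0∞) ≤ latticeSum G L := by
  have := hXfin.fintype
  let φ : Fin ℓ ≃ X := (Fintype.equivFinOfCardEq
    ((Nat.card_eq_fintype_card).symm.trans hcard)).symm
  choose v hv using fun j => (hXS (φ j).2).1
  let M (σ : Equiv.Perm (Fin ℓ)) : Fin n → Fin ℓ → ℤ := fun i j => v (σ j) i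
  set g := (Quotient.out (α := SLR n) L).1
  have hM (σ : Equiv.Perm (Fin ℓ)) (j : Fin ℓ) :
      (fun i => rowAct g (castMat (M σ)) i j) = φ (σ j) := by
    rw [hv (σ j)]
    ext i
    simp [rowAct_apply, castMat, M, Matrix.mulVec, dotProduct]
  have hinj : Function.Injective M := fun σ τ h => by
    ext j : 1
    refine φ.injective (Subtype.ext ?_)
    rw [← hM σ j, ← hM τ j, h]
  have hone (σ : Equiv.Perm (Fin ℓ)) : 1 ≤ G (rowAct g (castMat (M σ))) := by
    refine hG _ (fun j => ?_) (exists_det_rowMinor_ne_zero ?_)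
    · rw [hM]
      exact (hXS (φ (σ j)).2).2
    · rw [show (fun j i => rowAct g (castMat (M σ)) i j) = fun j => (φ (σ j)).1 from
        funext (hM σ)]
      exact hX.comp (fun j => φ (σ j)) (φ.injective.comp σ.injective)
  calc (ℓ.factorial : ℝ≥0∞) = ∑ _σ : Equiv.Perm (Fin ℓ), 1 := by
        simp [Fintype.card_perm]
    _ ≤ ∑ σ, G (rowAct g (castMat (M σ))) := Finset.sum_le_sum fun σ _ => hone σ
    _ = ∑' σ, G (rowAct g (castMat (M σ))) := (tsum_fintype _).symm
    _ ≤ latticeSum G L :=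
        ENNReal.tsum_comp_le_tsum_of_injective hinj fun M => G (rowAct g (castMat M))

lemma volume_setOf_forall_column_mem (S : Set (Fin n → ℝ)) (hS : MeasurableSet S) :
    volume {X : Fin n → Fin ℓ → ℝ | ∀ j, (fun i => X i j) ∈ S} = volume S ^ ℓ := by
  have h := (measurePreserving_transpose n ℓ).measure_preimage
    (MeasurableSet.univ_pi fun _ : Fin ℓ => hS).nullMeasurableSet
  rw [volume_pi_pi] at h
  simpa [Set.preimage, Set.mem_univ_pi] using h

end Counting

/-- For a Borel set `S ⊆ ℝⁿ` with `S ∩ (-S) = ∅` and `λ = Vol(S) ∈ (0, ∞)`, an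
`SL(n,ℝ)`-invariant Borel probability measure `μ` on the space of covolume-one
lattices, and `0 ≤ ℓ ≤ n - 1`, the probability that `L ∩ S` contains `ℓ` linearly
independent vectors is at most `λˡ / ℓ!`. -/
theorem prob_contains_ell_independent_vectors
    (n : ℕ) (hn : 1 ≤ n)
    (S : Set (Fin n → ℝ)) (hSmeas : MeasurableSet S)
    (hSsym : S ∩ (-S) = ∅) (hS0 : 0 < volume S) (hSfin : volume S < ⊤)
    (μ : Measure (LatticeSpace n)) (hprob : IsProbabilityMeasure μ)
    (hinv : ∀ g : SLR n, Measure.map (fun x => g • x) μ = μ)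
    (ℓ : ℕ) (hℓ : ℓ ≤ n - 1) :
    μ {L : LatticeSpace n | ∃ X : Set (Fin n → ℝ),
        X ⊆ latticeOf L ∩ S ∧ X.Finite ∧ X.ncard = ℓ ∧ indepSet X}
      ≤ ENNReal.ofReal ((volume S).toReal ^ ℓ / (Nat.factorial ℓ)) := by
  have : IsProbabilityMeasure μ := hprob
  set B := {L : LatticeSpace n | ∃ X : Set (Fin n → ℝ),
    X ⊆ latticeOf L ∩ S ∧ X.Finite ∧ X.ncard = ℓ ∧ indepSet X}
  have hA : MeasurableSet {X : Fin n → Fin ℓ → ℝ | ∀ j, (fun i => X i j) ∈ S} := by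
    simp only [Set.ofPred_forall]
    exact MeasurableSet.iInter fun j => measurableSet_preimage
      (measurable_pi_lambda _ fun i => by fun_prop) hSmeas
  have hmain : (ℓ.factorial : ℝ≥0∞) * μ B ≤ volume S ^ ℓ := by
    refine ENNReal.le_of_forall_pos_le_add fun δ hδ _ => ?_
    obtain ⟨G, hGlsc, hG, hGle⟩ := exists_lowerSemicontinuous_latticeSum_le hinv
      (by omega : ℓ < n) hA (ENNReal.coe_ne_zero.2 hδ.ne')
    rw [volume_setOf_forall_column_mem S hSmeas] at hGle
    refine le_trans ?_
      ((mul_meas_ge_le_lintegral (measurable_latticeSum hGlsc) ℓ.factorial).trans hGle)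
    gcongr
    rintro L ⟨X, hXS, hXfin, hcard, hX⟩
    exact factorial_le_latticeSum hG hXS hXfin hcard hX
  rw [ENNReal.ofReal_div_of_pos (by positivity), ENNReal.ofReal_pow ENNReal.toReal_nonneg,
    ENNReal.ofReal_toReal hSfin.ne, ENNReal.ofReal_natCast,
    ENNReal.le_div_iff_mul_le (Or.inl (by positivity)) (Or.inl (ENNReal.natCast_ne_top _)),
    mul_comm]
  exact hmain
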